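/- arXiv:1603.00589 — 3 statements merged into one kernel-verified Lean document; each statement's English description precedes it below -/
import Mathlib

section
/- Let N ≥ 2 and let M be an N×N real matrix with nonnegative entries that is irreducible. Then M has a center point: there exists a vector t ∈ ℝ^N with all entries strictly positive such that for every index i, t_i · (C t)_i = (M t)_i, where C is the incidence matrix of M (note that irreducibility guarantees (C t)_i > 0 for every i). -/
open Matrix

/-- Incidence matrix of a nonnegative matrix: `C i j = 1` if `M i j > 0`, else `0`. -/
noncomputable def incidence {N : ℕ} (M : Matrix (Fin N) (Fin N) ℝ) :
    Matrix (Fin N) (Fin N) ℝ :=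
  fun i j => if 0 < M i j then 1 else 0

/-- A nonnegative matrix is irreducible iff its directed graph (edge `a → b` when
`M a b > 0`) is strongly connected. -/
def MatIrreducible {N : ℕ} (M : Matrix (Fin N) (Fin N) ℝ) : Prop :=
  ∀ i j : Fin N, Relation.TransGen (fun a b => 0 < M a b) i j

section FixedPoint

open Polynomial MeasureTheory Metric

variable {E : Type*} [NormedAddCommGroup E] [InnerProductSpace ℝ E] [FiniteDimensional ℝ E]

theorem exists_polynomial_eval_eq_det_one_add_smul (A : E →L[ℝ] E) :
    ∃ p : ℝ[X], p.natDegree ≤ Module.finrank ℝ E ∧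
      ∀ t : ℝ, p.eval t = (1 + t • A : E →L[ℝ] E).det := by
  let b := Module.finBasis ℝ E
  let B := LinearMap.toMatrix b b (A : E →ₗ[ℝ] E)
  refine ⟨det ((X : ℝ[X]) • B.map C + (1 : Matrix _ _ ℝ).map C), ?_, fun t => ?_⟩
  · simpa using natDegree_det_X_add_C_le B 1
  · rw [← coe_evalRingHom, RingHom.map_det, ContinuousLinearMap.det, ← LinearMap.det_toMatrix b]
    congr 1
    ext i j
    simp [B, LinearMap.toMatrix_one, Matrix.one_apply, apply_ite (eval t), add_comm]
    ring

/-- Lagrange interpolation of `t ↦ det (1 + t A)` at nodes in `(0, δ)`, with weights that do not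
depend on `A`. -/
theorem exists_interpolation_det_one_add {δ : ℝ} (hδ : 0 < δ) :
    ∃ (s : Finset ℝ) (w : ℝ → ℝ), (∀ t ∈ s, 0 < t ∧ t < δ) ∧ ∑ t ∈ s, w t = 1 ∧
      ∀ A : E →L[ℝ] E, (1 + A).det = ∑ t ∈ s, w t * (1 + t • A : E →L[ℝ] E).det := by
  obtain ⟨s, hs, hcard⟩ := (Set.Ioo_infinite hδ).exists_subset_card_eq (Module.finrank ℝ E + 1)
  have hne : s.Nonempty := Finset.card_pos.mp (by omega)
  have hinj : Set.InjOn (id : ℝ → ℝ) s := Function.injective_id.injOn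
  refine ⟨s, fun t => (Lagrange.basis s id t).eval 1, fun t ht => hs ht, ?_, fun A => ?_⟩
  · rw [← eval_finsetSum, Lagrange.sum_basis hinj hne, eval_one]
  · obtain ⟨p, hp, hpe⟩ := exists_polynomial_eval_eq_det_one_add_smul A
    have hdeg : p.degree < (s.card : ℕ) :=
      (degree_le_natDegree).trans_lt (by rw [hcard]; exact_mod_cast Nat.lt_succ_of_le hp)
    have h := congrArg (eval 1) (Lagrange.eq_interpolate hinj hdeg)
    rw [hpe, one_smul, Lagrange.interpolate_apply, eval_finsetSum] at h
    rw [h]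
    refine Finset.sum_congr rfl fun t _ => ?_
    rw [eval_mul, eval_C, id, hpe, mul_comm]

theorem det_one_add_pos_of_norm_lt_one {A : E →L[ℝ] E} (hA : ‖A‖ < 1) : 0 < (1 + A).det := by
  by_contra! h
  have hc : ContinuousOn (fun t : ℝ => (1 + t • A : E →L[ℝ] E).det) (Set.Icc 0 1) :=
    (ContinuousLinearMap.continuous_det.comp (by fun_prop)).continuousOn
  obtain ⟨t, ht, h0⟩ := intermediate_value_Icc' zero_le_one hc
    (show (0 : ℝ) ∈ Set.Icc _ _ from ⟨by simpa using h, by simp [ContinuousLinearMap.det]⟩)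
  have hn : ‖-(t • A)‖ < 1 := by
    rw [norm_neg, norm_smul, Real.norm_of_nonneg ht.1]
    exact (mul_le_of_le_one_left (norm_nonneg A) ht.2).trans_lt hA
  have hu := isUnit_one_sub_of_norm_lt_one hn
  rw [sub_neg_eq_add] at hu
  have := hu.map (ContinuousLinearMap.toLinearMapRingHom (R₁ := ℝ) (M₁ := E))
  exact (LinearMap.isUnit_det _ this).ne_zero h0

theorem bijOn_ball_add_smul {K : NNReal} {R t : ℝ} {g : E → E} (hg : LipschitzWith K g)
    (h0 : ∀ x ∉ ball (0 : E) R, g x = 0) (ht : 0 ≤ t) (htK : t * K < 1) :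
    Set.BijOn (fun x => x + t • g x) (ball 0 R) (ball 0 R) := by
  have hc : ∀ y : E, ContractingWith (Real.toNNReal t * K) (fun x => y - t • g x) := by
    intro y
    refine ⟨?_, LipschitzWith.of_dist_le_mul fun a b => ?_⟩
    · rw [← NNReal.coe_lt_coe]; simpa [ht] using htK
    · rw [dist_sub_left, dist_smul₀, NNReal.coe_mul, Real.coe_toNNReal t ht,
        Real.norm_of_nonneg ht, mul_assoc]
      exact mul_le_mul_of_nonneg_left (hg.dist_le_mul a b) ht
  have hinj : Function.Injective (fun x => x + t • g x) := by
    intro a b hab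
    exact ((hc (a + t • g a)).fixedPoint_unique (x := a) (by simp [Function.IsFixedPt])).trans
      ((hc (a + t • g a)).fixedPoint_unique (x := b)
        (by simp only at hab; simp [Function.IsFixedPt, hab])).symm
  refine ⟨fun x hx => ?_, hinj.injOn, fun y hy => ?_⟩
  · by_contra hn
    have h : x + t • g x = x := hinj (by simp [h0 _ hn])
    exact hn (by simpa only [h] using hx)
  · have h := (hc y).fixedPoint_isFixedPt
    set x := ContractingWith.fixedPoint _ (hc y)
    have hxy : x + t • g x = y := by
      have : y - t • g x = x := h
      nth_rewrite 1 [← this]; abel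
    refine ⟨x, ?_, hxy⟩
    by_contra hn
    rw [h0 x hn, smul_zero, add_zero] at hxy
    exact hn (hxy ▸ hy)

omit [FiniteDimensional ℝ E] in
theorem lipschitzWith_indicator_ball {K : NNReal} {R : ℝ} {g : E → E}
    (hg : LipschitzOnWith K g (closedBall 0 R)) (h0 : ∀ x ∈ sphere (0 : E) R, g x = 0) :
    LipschitzWith K ((ball 0 R).indicator g) := by
  have key : ∀ x ∈ ball (0 : E) R, ∀ y ∉ ball (0 : E) R, dist (g x) 0 ≤ K * dist x y := by
    intro x hx y hy
    rw [mem_ball_zero_iff] at hx hy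
    have hc : ContinuousOn (fun s : ℝ => ‖AffineMap.lineMap x y s‖) (Set.Icc 0 1) := by
      fun_prop
    obtain ⟨s, hs, hsR⟩ := intermediate_value_Icc zero_le_one hc
      (show R ∈ Set.Icc _ _ by constructor <;> simp <;> linarith)
    have hz := h0 (AffineMap.lineMap x y s) (by simpa using hsR)
    have h := hg.dist_le_mul x (by simpa using hx.le) (AffineMap.lineMap x y s)
      (by simpa using hsR.le)
    rw [hz] at h
    refine h.trans (mul_le_mul_of_nonneg_left ?_ K.2)
    rw [dist_left_lineMap, Real.norm_of_nonneg hs.1]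
    exact mul_le_of_le_one_left dist_nonneg hs.2
  refine LipschitzWith.of_dist_le_mul fun x y => ?_
  by_cases hx : x ∈ ball (0 : E) R <;> by_cases hy : y ∈ ball (0 : E) R
  · simpa only [Set.indicator_of_mem hx, Set.indicator_of_mem hy] using
      hg.dist_le_mul x (ball_subset_closedBall hx) y (ball_subset_closedBall hy)
  · simpa only [Set.indicator_of_mem hx, Set.indicator_of_notMem hy] using key x hx y hy
  · rw [Set.indicator_of_notMem hx, Set.indicator_of_mem hy, dist_comm, dist_comm x]
    exact key y hy x hx
  · simp [hx, hy]; positivity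

theorem integral_det_one_add_fderiv [MeasurableSpace E] [BorelSpace E] {K : NNReal} {R : ℝ} {g : E → E}
    (hg : LipschitzWith K g) (h0 : ∀ x ∉ ball (0 : E) R, g x = 0)
    (hd : ContDiffOn ℝ 1 g (ball 0 R)) :
    ∫ x in ball (0 : E) R, (1 + fderiv ℝ g x).det = volume.real (ball (0 : E) R) := by
  have hdc : ContinuousOn (fderiv ℝ g) (ball 0 R) :=
    hd.continuousOn_fderiv_of_isOpen isOpen_ball le_rfl
  have hK : ∀ x, ‖fderiv ℝ g x‖ ≤ K := fun x => norm_fderiv_le_of_lipschitz ℝ hg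
  have hcont : ∀ t : ℝ, Continuous fun A : E →L[ℝ] E => (1 + t • A : E →L[ℝ] E).det :=
    fun t => ContinuousLinearMap.continuous_det.comp (by fun_prop)
  have hintegral : ∀ t : ℝ, IntegrableOn (fun x => (1 + t • fderiv ℝ g x : E →L[ℝ] E).det)
      (ball 0 R) := by
    intro t
    have : ProperSpace (E →L[ℝ] E) := FiniteDimensional.proper ℝ _
    obtain ⟨C, hC⟩ := (isCompact_closedBall (0 : E →L[ℝ] E) K).exists_bound_of_continuousOn
      (hcont t).continuousOn
    refine IntegrableOn.of_bound measure_ball_lt_top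
      (((hcont t).comp_continuousOn hdc).aestronglyMeasurable measurableSet_ball) C
      (Filter.Eventually.of_forall fun x => hC _ (by simpa using hK x))
  have hsmall : ∀ t : ℝ, 0 < t → t * K < 1 →
      ∫ x in ball (0 : E) R, (1 + t • fderiv ℝ g x : E →L[ℝ] E).det =
        volume.real (ball (0 : E) R) := by
    intro t ht htK
    have hbij := bijOn_ball_add_smul hg h0 ht.le htK
    have h := integral_image_eq_integral_abs_det_fderiv_smul volume
      (f' := fun x => 1 + t • fderiv ℝ g x) measurableSet_ball
      (fun x hx => ((hasFDerivAt_id x).add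
        (((hd.differentiableOn one_ne_zero).differentiableAt
          (isOpen_ball.mem_nhds hx)).hasFDerivAt.const_smul t)).hasFDerivWithinAt)
      hbij.injOn (fun _ => (1 : ℝ))
    simp only [id, Pi.smul_apply, Pi.add_apply] at h
    rw [hbij.image_eq] at h
    simp only [integral_const, smul_eq_mul, mul_one, measureReal_restrict_apply_univ] at h
    rw [h]
    refine integral_congr_ae (Filter.Eventually.of_forall fun x => ?_)
    refine (abs_of_pos (det_one_add_pos_of_norm_lt_one ?_)).symm
    rw [norm_smul, Real.norm_of_nonneg ht.le]
    exact (mul_le_mul_of_nonneg_left (hK x) ht.le).trans_lt htK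
  obtain ⟨s, w, hs, hw, hdet⟩ :=
    exists_interpolation_det_one_add (E := E) (δ := 1 / (K + 1)) (by positivity)
  rw [integral_congr_ae (Filter.Eventually.of_forall fun x => hdet (fderiv ℝ g x))]
  rw [integral_finsetSum _ fun t _ => (hintegral t).const_mul _]
  simp only [integral_const_mul]
  rw [Finset.sum_congr rfl fun t ht => by
    rw [hsmall t (hs t ht).1 ?_]
    have := (lt_div_iff₀ (by positivity)).mp (hs t ht).2
    nlinarith [(hs t ht).1], ← Finset.sum_mul, hw, one_mul]

/-- There is no `C¹` retraction of a closed ball onto its boundary sphere. -/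
theorem not_exists_contDiffOn_retraction_sphere {R : ℝ} (hR : 0 < R) {r : E → E}
    (hr : ContDiffOn ℝ 1 r (closedBall 0 R)) (hrR : ∀ x ∈ closedBall (0 : E) R, ‖r x‖ = R)
    (hfix : ∀ x ∈ sphere (0 : E) R, r x = x) : False := by
  borelize E
  have hsub : ContDiffOn ℝ 1 (fun x => r x - x) (closedBall 0 R) := hr.sub contDiffOn_id
  obtain ⟨K, hK⟩ := hsub.exists_lipschitzOnWith one_ne_zero (convex_closedBall 0 R)
    (isCompact_closedBall 0 R)
  have heq : Set.EqOn ((ball 0 R).indicator fun x => r x - x) (fun x => r x - x) (ball 0 R) :=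
    fun x hx => Set.indicator_of_mem hx _
  have hintegral := integral_det_one_add_fderiv
    (lipschitzWith_indicator_ball hK fun x hx => by rw [hfix x hx, sub_self])
    (fun x hx => Set.indicator_of_notMem hx _)
    ((hsub.mono ball_subset_closedBall).congr heq)
  have hdet : ∀ x ∈ ball (0 : E) R,
      (1 + fderiv ℝ ((ball 0 R).indicator fun x => r x - x) x : E →L[ℝ] E).det = 0 := by
    intro x hx
    have hnhds := isOpen_ball.mem_nhds hx
    have hrx : HasFDerivAt r (fderiv ℝ r x) x :=
      (((hr.mono ball_subset_closedBall).differentiableOn one_ne_zero).differentiableAt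
        hnhds).hasFDerivAt
    have hf : fderiv ℝ ((ball 0 R).indicator fun x => r x - x) x =
        fderiv ℝ r x - ContinuousLinearMap.id ℝ E :=
      ((hrx.sub (hasFDerivAt_id x)).congr_of_eventuallyEq
        (Filter.eventuallyEq_of_mem hnhds heq)).fderiv
    have horth : ∀ h, inner ℝ (r x) (fderiv ℝ r x h) = 0 := by
      have hconst : HasFDerivAt (fun y => ‖r y‖ ^ 2) (0 : E →L[ℝ] ℝ) x :=
        (hasFDerivAt_const (R ^ 2) x).congr_of_eventuallyEq
          (Filter.eventuallyEq_of_mem hnhds fun y hy => by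
            simp only [hrR y (ball_subset_closedBall hy)])
      intro h
      have := congrArg (fun L : E →L[ℝ] ℝ => L h) (hrx.norm_sq.unique hconst)
      simpa using this
    rw [hf, ← ContinuousLinearMap.one_def, add_sub_cancel]
    by_contra hne
    obtain ⟨h, hh⟩ := (LinearEquiv.ofIsUnitDet (f := (fderiv ℝ r x : E →ₗ[ℝ] E))
      (v := Module.finBasis ℝ E) (v' := Module.finBasis ℝ E)
      (by rw [LinearMap.det_toMatrix]; exact isUnit_iff_ne_zero.mpr hne)).surjective (r x)
    have hh' : fderiv ℝ r x h = r x := hh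
    have h0 := horth h
    rw [hh', real_inner_self_eq_norm_sq, hrR x (ball_subset_closedBall hx)] at h0
    exact (pow_pos hR 2).ne' h0
  rw [setIntegral_congr_fun measurableSet_ball hdet] at hintegral
  have hpos : 0 < volume.real (ball (0 : E) R) :=
    ENNReal.toReal_pos (measure_ball_pos _ _ hR).ne' measure_ball_lt_top.ne
  simp at hintegral
  linarith

/-- **Brouwer's fixed point theorem** for bounded `C¹` self-maps of a Euclidean space. -/
theorem exists_fixedPoint_of_contDiff_of_norm_lt {F : E → E} (hF : ContDiff ℝ 1 F) {R : ℝ}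
    (hR : ∀ x, ‖F x‖ < R) : ∃ x, F x = x := by
  by_contra! hne
  have hR0 : 0 < R := (norm_nonneg _).trans_lt (hR 0)
  let v : E → E := fun x => x - F x
  have hv : ContDiff ℝ 1 v := contDiff_id.sub hF
  have hv0 : ∀ x, 0 < ‖v x‖ ^ 2 := fun x =>
    pow_pos (norm_pos_iff.mpr (sub_ne_zero.mpr (hne x).symm)) 2
  let a : E → ℝ := fun x => inner ℝ x (v x)
  have ha : ContDiff ℝ 1 a := contDiff_id.inner ℝ hv
  let D : E → ℝ := fun x => a x ^ 2 + ‖v x‖ ^ 2 * (R ^ 2 - ‖x‖ ^ 2)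
  have hD : ContDiff ℝ 1 D :=
    (ha.pow 2).add ((hv.norm_sq ℝ).mul (contDiff_const.sub (contDiff_id.norm_sq ℝ)))
  have ha0 : ∀ x, ‖x‖ = R → 0 < a x := by
    intro x hx
    have h1 := real_inner_le_norm x (F x)
    have h2 : a x = R ^ 2 - inner ℝ x (F x) := by
      simp only [a, v, inner_sub_right, real_inner_self_eq_norm_sq, hx]
    rw [hx] at h1
    nlinarith [hR x]
  have hD0 : ∀ x ∈ closedBall (0 : E) R, 0 < D x := by
    intro x hx
    rw [mem_closedBall_zero_iff] at hx
    rcases hx.eq_or_lt with h | h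
    · simp only [D, h, sub_self, mul_zero, add_zero]
      exact pow_pos (ha0 x h) 2
    · have : 0 < R ^ 2 - ‖x‖ ^ 2 := by nlinarith [norm_nonneg x]
      have := mul_pos (hv0 x) this
      positivity
  let c : E → ℝ := fun x => (√(D x) - a x) / ‖v x‖ ^ 2
  refine not_exists_contDiffOn_retraction_sphere hR0 (r := fun x => x + c x • v x) ?_ ?_ ?_
  · refine contDiffOn_id.add (ContDiffOn.smul (ContDiffOn.div (ContDiffOn.sub
      (hD.contDiffOn.sqrt fun x hx => (hD0 x hx).ne') ha.contDiffOn)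
      (hv.norm_sq ℝ).contDiffOn fun x _ => (hv0 x).ne') hv.contDiffOn)
  · intro x hx
    have hS := Real.sq_sqrt (hD0 x hx).le
    have hc : c x * ‖v x‖ ^ 2 = √(D x) - a x := div_mul_cancel₀ _ (hv0 x).ne'
    rw [← sq_eq_sq₀ (norm_nonneg _) hR0.le, norm_add_sq_real, inner_smul_right, norm_smul, mul_pow,
      Real.norm_eq_abs, sq_abs]
    apply mul_left_cancel₀ (hv0 x).ne'
    change _ * (_ + 2 * (c x * a x) + _) = _
    have hDx : D x = a x ^ 2 + ‖v x‖ ^ 2 * (R ^ 2 - ‖x‖ ^ 2) := rfl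
    have hs : √(D x) = c x * ‖v x‖ ^ 2 + a x := by linarith
    rw [hs, hDx] at hS
    linear_combination hS
  · intro x hx
    rw [mem_sphere_zero_iff_norm] at hx
    have hDx : D x = a x ^ 2 := by simp [D, hx]
    simp [c, hDx, Real.sqrt_sq (ha0 x hx).le]

end FixedPoint

theorem incidence_mulVec_pos {N : ℕ} {M : Matrix (Fin N) (Fin N) ℝ} {t : Fin N → ℝ}
    (ht : ∀ i, 0 < t i) {i : Fin N} (hi : ∃ j, 0 < M i j) : 0 < (incidence M *ᵥ t) i := by
  obtain ⟨j, hj⟩ := hi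
  refine Finset.sum_pos' (fun k _ => mul_nonneg ?_ (ht k).le) ⟨j, Finset.mem_univ j, ?_⟩
  · unfold incidence; split_ifs <;> norm_num
  · simpa [incidence, hj] using ht j

/-- A nonnegative matrix with no zero row has a center point. -/
theorem exists_center_point_of_row_pos {N : ℕ} {M : Matrix (Fin N) (Fin N) ℝ}
    (hpos : ∀ i j, 0 ≤ M i j) (hrow : ∀ i, ∃ j, 0 < M i j) :
    ∃ t : Fin N → ℝ, (∀ i, 0 < t i) ∧
      ∀ i, t i * (incidence M *ᵥ t) i = (M *ᵥ t) i := by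
  obtain ⟨B, hB⟩ : ∃ B : ℝ, ∀ i j, |Real.log (M i j)| ≤ B := by
    obtain ⟨B, hB⟩ := Set.finite_range (fun p : Fin N × Fin N => |Real.log (M p.1 p.2)|) |>.bddAbove
    exact ⟨B, fun i j => hB ⟨(i, j), rfl⟩⟩
  have hle : ∀ i j, M i j ≤ Real.exp B * incidence M i j ∧
      Real.exp (-B) * incidence M i j ≤ M i j := by
    intro i j
    unfold incidence
    split_ifs with h
    · have := abs_le.mp (hB i j)
      rw [mul_one, mul_one, ← Real.log_le_iff_le_exp h, ← Real.le_log_iff_exp_le h]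
      exact ⟨this.2, this.1⟩
    · simp [le_antisymm (not_lt.mp h) (hpos i j)]
  let e : EuclideanSpace ℝ (Fin N) → Fin N → ℝ := fun u j => Real.exp (u j)
  have he : ∀ u j, 0 < e u j := fun u j => Real.exp_pos _
  have hC : ∀ u i, 0 < (incidence M *ᵥ e u) i := fun u i => incidence_mulVec_pos (he u) (hrow i)
  have hlow : ∀ u i, Real.exp (-B) * (incidence M *ᵥ e u) i ≤ (M *ᵥ e u) i := by
    intro u i
    simp only [Matrix.mulVec, dotProduct, Finset.mul_sum, ← mul_assoc]
    exact Finset.sum_le_sum fun j _ => mul_le_mul_of_nonneg_right (hle i j).2 (he u j).le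
  have hup : ∀ u i, (M *ᵥ e u) i ≤ Real.exp B * (incidence M *ᵥ e u) i := by
    intro u i
    simp only [Matrix.mulVec, dotProduct, Finset.mul_sum, ← mul_assoc]
    exact Finset.sum_le_sum fun j _ => mul_le_mul_of_nonneg_right (hle i j).1 (he u j).le
  have hM : ∀ u i, 0 < (M *ᵥ e u) i := fun u i =>
    (mul_pos (Real.exp_pos _) (hC u i)).trans_le (hlow u i)
  let F : EuclideanSpace ℝ (Fin N) → EuclideanSpace ℝ (Fin N) := fun u =>
    WithLp.toLp 2 fun i => Real.log ((M *ᵥ e u) i / (incidence M *ᵥ e u) i)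
  have hsmooth : ∀ (A : Matrix (Fin N) (Fin N) ℝ) i, ContDiff ℝ 1 fun u => (A *ᵥ e u) i := by
    intro A i
    simp only [Matrix.mulVec, dotProduct, e]
    fun_prop
  have hF : ContDiff ℝ 1 F := by
    rw [contDiff_euclidean]
    exact fun i => ((hsmooth M i).div (hsmooth _ i) fun u => (hC u i).ne').log
      fun u => (div_pos (hM u i) (hC u i)).ne'
  have hbound : ∀ u, ‖F u‖ < N * B ^ 2 + 1 := by
    intro u
    have hsq : ‖F u‖ ^ 2 ≤ N * B ^ 2 := by
      rw [EuclideanSpace.real_norm_sq_eq]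
      refine (Finset.sum_le_card_nsmul _ _ (B ^ 2) fun i _ => ?_).trans (by simp)
      refine sq_le_sq' ?_ ?_
      · exact (Real.le_log_iff_exp_le (div_pos (hM u i) (hC u i))).mpr
          ((le_div_iff₀ (hC u i)).mpr (hlow u i))
      · exact (Real.log_le_iff_le_exp (div_pos (hM u i) (hC u i))).mpr
          ((div_le_iff₀ (hC u i)).mpr (hup u i))
    nlinarith [norm_nonneg (F u), sq_nonneg (‖F u‖ - 1)]
  obtain ⟨u, hu⟩ := exists_fixedPoint_of_contDiff_of_norm_lt hF hbound
  refine ⟨e u, he u, fun i => ?_⟩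
  have hi : Real.log ((M *ᵥ e u) i / (incidence M *ᵥ e u) i) = u i :=
    congrArg (fun x : EuclideanSpace ℝ (Fin N) => x i) hu
  have hei : e u i = (M *ᵥ e u) i / (incidence M *ᵥ e u) i := by
    change Real.exp (u i) = _
    rw [← hi, Real.exp_log (div_pos (hM u i) (hC u i))]
  rw [hei, div_mul_cancel₀ _ (hC u i).ne']

/-- Every nonnegative irreducible N×N matrix (N ≥ 2) has a center point. -/
theorem center_point_exists (N : ℕ) (hN : 2 ≤ N) (M : Matrix (Fin N) (Fin N) ℝ)
    (hpos : ∀ i j, 0 ≤ M i j) (hirr : MatIrreducible M) :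
    ∃ t : Fin N → ℝ, (∀ i, 0 < t i) ∧
      ∀ i, t i * (incidence M *ᵥ t) i = (M *ᵥ t) i := by
  refine exists_center_point_of_row_pos hpos fun i => ?_
  obtain ⟨j, hij, -⟩ := Relation.TransGen.head'_iff.mp (hirr i i)
  exact ⟨j, hij⟩
end

section
/- Let M be an N×N real matrix with nonnegative entries, C its incidence matrix, and t a center point of M (so t has positive entries and t_i = (M t)_i/(C t)_i with (C t)_i > 0 for all i). Let δ ∈ ℝ^N be any vector such that t + δ has all entries strictly positive, and define the next iterate t' by t'_i = (M (t+δ))_i / (C (t+δ))_i. Define the N×N matrices A and B by A_ij = t_i · M_ij / (M t)_i and B_ij = t_i · C_ij / (C t)_i. Then for every index i, the new error satisfies the exact identity t'_i − t_i = [1 / (1 + (C δ)_i/(C t)_i)] · ((A − B) δ)_i. -/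
open Matrix

theorem incidence_nonneg {N : ℕ} (M : Matrix (Fin N) (Fin N) ℝ) (i j : Fin N) :
    0 ≤ incidence M i j := by
  unfold incidence
  split_ifs <;> norm_num

/-- Whether a row of the incidence matrix pairs positively with a positive vector does not
depend on the vector. -/
theorem incidence_mulVec_pos_of_pos {N : ℕ} (M : Matrix (Fin N) (Fin N) ℝ) {s t : Fin N → ℝ}
    (hs : ∀ j, 0 < s j) {i : Fin N} (h : 0 < (incidence M *ᵥ t) i) :
    0 < (incidence M *ᵥ s) i := by
  obtain ⟨j, -, hj⟩ :=
    Finset.exists_ne_zero_of_sum_ne_zero (show ∑ j, incidence M i j * t j ≠ 0 from h.ne')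
  refine Finset.sum_pos' (fun k _ => mul_nonneg (incidence_nonneg M i k) (hs k).le)
    ⟨j, Finset.mem_univ j, mul_pos ?_ (hs j)⟩
  exact (incidence_nonneg M i j).lt_of_ne' (left_ne_zero_of_mul hj)

/-- Scaling the rows of a matrix scales the entries of its products with vectors. -/
theorem mulVec_apply_of_row_scaled {N : ℕ} {K A : Matrix (Fin N) (Fin N) ℝ} {i : Fin N} {a b : ℝ}
    (h : ∀ j, A i j = a * K i j / b) (δ : Fin N → ℝ) :
    (A *ᵥ δ) i = a * (K *ᵥ δ) i / b := by
  simp only [mulVec, dotProduct, h, Finset.mul_sum, Finset.sum_div]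
  exact Finset.sum_congr rfl fun j _ => by ring

/-- Exact error identity for one step of the center-point iteration. -/
theorem error_identity (N : ℕ) (M : Matrix (Fin N) (Fin N) ℝ)
    (hpos : ∀ i j, 0 ≤ M i j)
    (t : Fin N → ℝ) (ht : ∀ i, 0 < t i)
    (hCt : ∀ i, 0 < (incidence M *ᵥ t) i)
    (hcp : ∀ i, t i = (M *ᵥ t) i / (incidence M *ᵥ t) i)
    (δ : Fin N → ℝ) (hδ : ∀ i, 0 < t i + δ i)
    (t' : Fin N → ℝ)
    (ht' : ∀ i, t' i = (M *ᵥ (t + δ)) i / (incidence M *ᵥ (t + δ)) i)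
    (A B : Matrix (Fin N) (Fin N) ℝ)
    (hA : ∀ i j, A i j = t i * M i j / (M *ᵥ t) i)
    (hB : ∀ i j, B i j = t i * incidence M i j / (incidence M *ᵥ t) i) :
    ∀ i, t' i - t i =
      (1 / (1 + (incidence M *ᵥ δ) i / (incidence M *ᵥ t) i)) * (((A - B) *ᵥ δ) i) := by
  intro i
  have hc := hCt i
  have hsum := incidence_mulVec_pos_of_pos M (s := t + δ) hδ hc
  have hM : (M *ᵥ t) i = t i * (incidence M *ᵥ t) i := by
    rw [← div_eq_iff hc.ne', ← hcp i]
  have hti := (ht i).ne'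
  rw [ht' i, sub_mulVec, Pi.sub_apply, mulVec_apply_of_row_scaled (hA i),
    mulVec_apply_of_row_scaled (hB i)]
  rw [mulVec_add, Pi.add_apply] at hsum
  rw [mulVec_add, mulVec_add, Pi.add_apply, Pi.add_apply, hM, one_add_div hc.ne']
  have hne := hsum.ne'
  have hc' := hc.ne'
  field_simp
  ring
end

section
/- Let N ≥ 2 and let C be an N×N irreducible matrix all of whose entries are 0 or 1. Suppose t ∈ ℝ^N has all entries strictly positive and satisfies t_i · (C t)_i = (C (t∘t))_i for every i, where (t∘t)_j = t_j² denotes the entrywise square; that is, t is a center point of the matrix C·diag(t). Then all entries of t are equal, i.e., t is a scalar multiple of the all-ones vector e. -/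
open Matrix

/-- Maximum principle: if `t i` is a maximal entry of `t` and equals the average of `t` with
weights `C i j * t j`, then `t` takes the value `t i` at every `j` with `0 < C i j`. -/
theorem eq_of_mulVec_sq_eq_of_forall_le {ι : Type*} [Fintype ι] {C : Matrix ι ι ℝ} {t : ι → ℝ}
    {i : ι} (hC : ∀ j, 0 ≤ C i j) (ht : ∀ j, 0 < t j) (hmax : ∀ j, t j ≤ t i)
    (hfix : t i * (C *ᵥ t) i = (C *ᵥ fun j => t j ^ 2) i) {j : ι} (hj : 0 < C i j) :
    t j = t i := by
  have hsum : ∑ k, C i k * t k * (t i - t k) = 0 := by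
    simp only [mulVec, dotProduct, Finset.mul_sum] at hfix
    rw [← sub_eq_zero, ← Finset.sum_sub_distrib] at hfix
    rw [← hfix]
    exact Finset.sum_congr rfl fun k _ => by ring
  have hnonneg : ∀ k ∈ Finset.univ, 0 ≤ C i k * t k * (t i - t k) := fun k _ =>
    mul_nonneg (mul_nonneg (hC k) (ht k).le) (sub_nonneg.2 (hmax k))
  have hzero := (Finset.sum_eq_zero_iff_of_nonneg hnonneg).1 hsum j (Finset.mem_univ j)
  have hpos : 0 < C i j * t j := mul_pos hj (ht j)
  exact (sub_eq_zero.1 ((mul_eq_zero.1 hzero).resolve_left hpos.ne')).symm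

/-- A positive center point of C·diag(t) has all entries equal. -/
theorem center_point_of_Cdiag (N : ℕ) (hN : 2 ≤ N) (C : Matrix (Fin N) (Fin N) ℝ)
    (h01 : ∀ i j, C i j = 0 ∨ C i j = 1) (hirr : MatIrreducible C)
    (t : Fin N → ℝ) (ht : ∀ i, 0 < t i)
    (hfix : ∀ i, t i * (C *ᵥ t) i = (C *ᵥ fun j => t j ^ 2) i) :
    ∃ c : ℝ, t = fun _ => c := by
  have : Nonempty (Fin N) := ⟨⟨0, by omega⟩⟩
  obtain ⟨m, hm⟩ := Finite.exists_max t
  have hC : ∀ i j, 0 ≤ C i j := fun i j => by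
    rcases h01 i j with h | h <;> simp [h]
  have step : ∀ a b, t a = t m → 0 < C a b → t b = t m := fun a b ha hab =>
    (eq_of_mulVec_sq_eq_of_forall_le (hC a) ht (fun j => ha ▸ hm j) (hfix a) hab).trans ha
  refine ⟨t m, funext fun j => ?_⟩
  induction hirr m j with
  | single h => exact step _ _ rfl h
  | tail _ h ih => exact step _ _ ih h
end
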